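/- Suppose there exists a large set of Kirkman triple systems of order q + 2 where q ≡ 1 (mod 6) is a prime power. Then for every integer n ≥ 2 there exists a large set of Kirkman triple systems of order qⁿ + 2. -/

import Mathlib

/-- A Steiner triple system: every block has 3 points and every pair of
distinct points lies in exactly one block. -/
def isSTS {X : Type*} (B : Finset (Finset X)) : Prop :=
  (∀ b ∈ B, b.card = 3) ∧ ∀ x y : X, x ≠ y → ∃! b, b ∈ B ∧ x ∈ b ∧ y ∈ b

/-- A parallel class: every point lies in exactly one block of `P`. -/
def isParallelClass {X : Type*} (P : Finset (Finset X)) : Prop :=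
  ∀ x : X, ∃! b, b ∈ P ∧ x ∈ b

/-- A Kirkman triple system: a Steiner triple system whose blocks can be
partitioned into parallel classes. -/
def isKTS {X : Type*} (B : Finset (Finset X)) : Prop :=
  isSTS B ∧ ∃ A : Finset (Finset (Finset X)),
    (∀ P ∈ A, P ⊆ B ∧ isParallelClass P) ∧ (∀ b ∈ B, ∃! P, P ∈ A ∧ b ∈ P)

/-- A large set of Kirkman triple systems of order `v`: a family of `v - 2`
pairwise disjoint KTS on a `v`-set. -/
def LKTS (v : ℕ) : Prop :=
  ∃ B : Fin (v - 2) → Finset (Finset (Fin v)),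
    (∀ i, isKTS (B i)) ∧ ∀ i j, i ≠ j → Disjoint (B i) (B j)

/-- `C` lists the parallel classes of a Kirkman triple system on the point set `S`. -/
structure IsKTSOn {Y ι : Type*} (S : Set Y) (C : ι → Set (Finset Y)) : Prop where
  card : ∀ {i b}, b ∈ C i → b.card = 3
  subset : ∀ {i b p}, b ∈ C i → p ∈ b → p ∈ S
  pair : ∀ {p r}, p ∈ S → r ∈ S → p ≠ r → ∃ i, ∃ b ∈ C i, p ∈ b ∧ r ∈ b
  pair_unique : ∀ {i j b b' p r}, b ∈ C i → b' ∈ C j → p ≠ r → p ∈ b → r ∈ b →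
    p ∈ b' → r ∈ b' → b = b'
  class_unique : ∀ {i j b}, b ∈ C i → b ∈ C j → i = j
  cover : ∀ i {p}, p ∈ S → ∃ b ∈ C i, p ∈ b
  cover_unique : ∀ {i b b' p}, b ∈ C i → b' ∈ C i → p ∈ b → p ∈ b' → b = b'

namespace IsKTSOn

variable {X Y ι κ : Type*} {S : Set X} {C : ι → Set (Finset X)}

lemma reindex (h : IsKTSOn S C) (e : κ ≃ ι) : IsKTSOn S (C ∘ e) where
  card hb := h.card hb
  subset hb := h.subset hb
  pair hp hr hpr := by
    obtain ⟨i, b, hb⟩ := h.pair hp hr hpr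
    exact ⟨e.symm i, b, by simpa using hb⟩
  pair_unique hb hb' := h.pair_unique hb hb'
  class_unique hb hb' := e.injective (h.class_unique hb hb')
  cover i _ hp := h.cover (e i) hp
  cover_unique hb hb' := h.cover_unique hb hb'

lemma map (h : IsKTSOn S C) (g : X ↪ Y) :
    IsKTSOn (g '' S) fun i => Finset.map g '' C i where
  card := by
    rintro i _ ⟨b, hb, rfl⟩
    simpa using h.card hb
  subset := by
    rintro i _ p ⟨b, hb, rfl⟩ hp
    obtain ⟨x, hx, rfl⟩ := Finset.mem_map.1 hp
    exact ⟨x, h.subset hb hx, rfl⟩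
  pair := by
    rintro _ _ ⟨p, hp, rfl⟩ ⟨r, hr, rfl⟩ hpr
    obtain ⟨i, b, hb, hpb, hrb⟩ := h.pair hp hr (ne_of_apply_ne _ hpr)
    exact ⟨i, _, ⟨b, hb, rfl⟩, Finset.mem_map_of_mem _ hpb, Finset.mem_map_of_mem _ hrb⟩
  pair_unique := by
    rintro i j _ _ _ _ ⟨b, hb, rfl⟩ ⟨b', hb', rfl⟩ hpr hp hr hp' hr'
    obtain ⟨p, -, rfl⟩ := Finset.mem_map.1 hp
    obtain ⟨r, -, rfl⟩ := Finset.mem_map.1 hr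
    rw [Finset.mem_map' g] at hp hr hp' hr'
    rw [h.pair_unique hb hb' (ne_of_apply_ne _ hpr) hp hr hp' hr']
  class_unique := by
    rintro i j _ ⟨b, hb, rfl⟩ ⟨b', hb', e⟩
    rw [Finset.map_injective g e] at hb'
    exact h.class_unique hb hb'
  cover := by
    rintro i _ ⟨p, hp, rfl⟩
    obtain ⟨b, hb, hpb⟩ := h.cover i hp
    exact ⟨_, ⟨b, hb, rfl⟩, Finset.mem_map_of_mem _ hpb⟩
  cover_unique := by
    rintro i _ _ _ ⟨b, hb, rfl⟩ ⟨b', hb', rfl⟩ hp hp'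
    obtain ⟨p, -, rfl⟩ := Finset.mem_map.1 hp
    rw [Finset.mem_map' g] at hp hp'
    rw [h.cover_unique hb hb' hp hp']

open Classical in
lemma exists_isKTS [Fintype X] (h : IsKTSOn Set.univ C) :
    ∃ B, isKTS B ∧ ∀ b ∈ B, ∃ i, b ∈ C i := by
  refine ⟨Finset.univ.filter fun b => ∃ i, b ∈ C i, ⟨⟨fun b hb => ?_, fun x y hxy => ?_⟩,
    Finset.univ.filter fun P => ∃ i, P = Finset.univ.filter (· ∈ C i), ?_, ?_⟩,
    fun b hb => (Finset.mem_filter.1 hb).2⟩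
  · obtain ⟨i, hb⟩ := (Finset.mem_filter.1 hb).2
    exact h.card hb
  · obtain ⟨i, b, hb, hx, hy⟩ := h.pair (Set.mem_univ x) (Set.mem_univ y) hxy
    refine ⟨b, ⟨by simpa using ⟨i, hb⟩, hx, hy⟩, ?_⟩
    rintro b' ⟨hb', hx', hy'⟩
    obtain ⟨j, hb'⟩ := (Finset.mem_filter.1 hb').2
    exact h.pair_unique hb' hb hxy hx' hy' hx hy
  · intro P hP
    obtain ⟨i, rfl⟩ := (Finset.mem_filter.1 hP).2
    refine ⟨fun b hb => ?_, fun x => ?_⟩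
    · simpa using ⟨i, (Finset.mem_filter.1 hb).2⟩
    · obtain ⟨b, hb, hx⟩ := h.cover i (Set.mem_univ x)
      refine ⟨b, ⟨by simpa using hb, hx⟩, ?_⟩
      rintro b' ⟨hb', hx'⟩
      exact h.cover_unique (Finset.mem_filter.1 hb').2 hb hx' hx
  · intro b hb
    obtain ⟨i, hb⟩ := (Finset.mem_filter.1 hb).2
    refine ⟨Finset.univ.filter (· ∈ C i), ⟨by simpa using ⟨i, rfl⟩, by simpa using hb⟩, ?_⟩
    rintro P ⟨hP, hbP⟩
    obtain ⟨j, rfl⟩ := (Finset.mem_filter.1 hP).2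
    rw [h.class_unique (Finset.mem_filter.1 hbP).2 hb]

end IsKTSOn

lemma isSTS.pair_unique {X : Type*} {B : Finset (Finset X)} (h : isSTS B) {b b' : Finset X}
    {x y : X} (hb : b ∈ B) (hb' : b' ∈ B) (hxy : x ≠ y) (hx : x ∈ b) (hy : y ∈ b)
    (hx' : x ∈ b') (hy' : y ∈ b') : b = b' :=
  (h.2 x y hxy).unique ⟨hb, hx, hy⟩ ⟨hb', hx', hy'⟩

namespace isKTS

variable {X : Type*} {B : Finset (Finset X)}

lemma isKTSOn_of_resolution (hB : isSTS B) {A : Finset (Finset (Finset X))}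
    (hA : ∀ P ∈ A, P ⊆ B ∧ isParallelClass P) (hAB : ∀ b ∈ B, ∃! P, P ∈ A ∧ b ∈ P) :
    IsKTSOn Set.univ fun P : A => {b | b ∈ P.1} where
  card {P _} hb := hB.1 _ ((hA _ P.2).1 hb)
  subset _ _ := Set.mem_univ _
  pair {p r} _ _ hpr := by
    obtain ⟨b, ⟨hb, hp, hr⟩, -⟩ := hB.2 p r hpr
    obtain ⟨P, ⟨hP, hbP⟩, -⟩ := hAB b hb
    exact ⟨⟨P, hP⟩, b, hbP, hp, hr⟩
  pair_unique {P Q _ _ _ _} hb hb' hpr :=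
    hB.pair_unique ((hA _ P.2).1 hb) ((hA _ Q.2).1 hb') hpr
  class_unique {P Q _} hb hb' :=
    Subtype.ext ((hAB _ ((hA _ P.2).1 hb)).unique ⟨P.2, hb⟩ ⟨Q.2, hb'⟩)
  cover P p _ := by
    obtain ⟨b, ⟨hb, hp⟩, -⟩ := (hA _ P.2).2 p
    exact ⟨b, hb, hp⟩
  cover_unique {P _ _ _} hb hb' hp hp' := ((hA _ P.2).2 _).unique ⟨hb, hp⟩ ⟨hb', hp'⟩

open Classical in
lemma two_mul_card_classes [Fintype X] {ι : Type*} [Fintype ι] {C : ι → Set (Finset X)}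
    (h : IsKTSOn Set.univ C) (x : X) : 2 * Fintype.card ι + 1 = Fintype.card X := by
  choose blk hblk hx using fun i => h.cover i (Set.mem_univ x)
  have hU : Finset.univ.erase x = Finset.univ.biUnion fun i => (blk i).erase x := by
    ext y
    simp only [Finset.mem_erase, Finset.mem_univ, and_true, Finset.mem_biUnion, true_and]
    refine ⟨fun hy => ?_, fun ⟨i, hy, _⟩ => hy⟩
    obtain ⟨i, b, hb, hyb, hxb⟩ := h.pair (Set.mem_univ y) (Set.mem_univ x) hy
    exact ⟨i, hy, h.cover_unique hb (hblk i) hxb (hx i) ▸ hyb⟩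
  have hc := congrArg Finset.card hU
  rw [Finset.card_biUnion, Finset.card_erase_of_mem (Finset.mem_univ x), Finset.card_univ] at hc
  · have h2 : ∀ i, ((blk i).erase x).card = 2 := fun i => by
      rw [Finset.card_erase_of_mem (hx i), h.card (hblk i)]
    simp only [h2, Finset.sum_const, Finset.card_univ, smul_eq_mul] at hc
    have : 0 < Fintype.card X := Fintype.card_pos_iff.2 ⟨x⟩
    omega
  · intro i _ j _ hij
    rw [Function.onFun, Finset.disjoint_left]
    intro y hy hy'
    rw [Finset.mem_erase] at hy hy'
    have e := h.pair_unique (hblk i) (hblk j) hy.1 hy.2 (hx i) hy'.2 (hx j)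
    exact hij (h.class_unique (hblk i) (e ▸ hblk j))

open Classical in
lemma exists_isKTSOn [Fintype X] {η : Type*} [Fintype η] (hB : isKTS B)
    (hX : Fintype.card X = 2 * Fintype.card η + 3) {b₀ : Finset X} (hb₀ : b₀ ∈ B) :
    ∃ C : Option η → Set (Finset X), IsKTSOn Set.univ C ∧ (∀ i, ∀ b ∈ C i, b ∈ B) ∧
      b₀ ∈ C none := by
  obtain ⟨hS, A, hA, hAB⟩ := hB
  have h := isKTSOn_of_resolution hS hA hAB
  obtain ⟨P, ⟨hP, hbP⟩, -⟩ := hAB b₀ hb₀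
  have : Nonempty X := Fintype.card_pos_iff.1 (by omega)
  have hc := two_mul_card_classes h (Classical.arbitrary X)
  have hcard : Fintype.card (Option η) = Fintype.card A := by
    rw [Fintype.card_option]
    omega
  let e := (Fintype.equivOfCardEq hcard).trans
    (Equiv.swap (Fintype.equivOfCardEq hcard none) ⟨P, hP⟩)
  refine ⟨_, h.reindex e, fun i b hb => (hA _ (e i).2).1 hb, ?_⟩
  have : e none = ⟨P, hP⟩ := by simp [e]
  simpa [this] using hbP

end isKTS

/-- The points of `L` together with the two points at infinity. -/
def withInfinity {V : Type*} (L : Finset V) : Set (V ⊕ Bool) :=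
  {p | ∀ v, p = Sum.inl v → v ∈ L}

/-- The block joining `x` to the two points at infinity. -/
def infinityBlock {V : Type*} (x : V) : Finset (V ⊕ Bool) :=
  ({x} : Finset V).disjSum Finset.univ

section infinityBlock

variable {V : Type*}

@[simp] lemma inl_mem_withInfinity {L : Finset V} {v : V} :
    (Sum.inl v : V ⊕ Bool) ∈ withInfinity L ↔ v ∈ L := by
  simp [withInfinity]

@[simp] lemma inr_mem_withInfinity {L : Finset V} {c : Bool} :
    (Sum.inr c : V ⊕ Bool) ∈ withInfinity L := by
  simp [withInfinity]

@[simp] lemma inl_mem_infinityBlock {x v : V} :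
    (Sum.inl v : V ⊕ Bool) ∈ infinityBlock x ↔ v = x := by
  simp [infinityBlock]

@[simp] lemma inr_mem_infinityBlock {x : V} {c : Bool} :
    (Sum.inr c : V ⊕ Bool) ∈ infinityBlock x := by
  simp [infinityBlock]

lemma infinityBlock_injective : Function.Injective (infinityBlock (V := V)) := fun x y h => by
  have : (Sum.inl x : V ⊕ Bool) ∈ infinityBlock y := h ▸ inl_mem_infinityBlock.2 rfl
  exact inl_mem_infinityBlock.1 this

open Classical in
lemma exists_eq_infinityBlock {b : Finset (V ⊕ Bool)} (hb : b.card = 3)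
    (h : ∀ c, Sum.inr c ∈ b) : ∃ x, b = infinityBlock x := by
  have hsub : (Finset.univ : Finset Bool).map .inr ⊆ b := by
    intro p hp
    obtain ⟨c, -, rfl⟩ := Finset.mem_map.1 hp
    exact h c
  obtain ⟨p, hp, hpn⟩ := Finset.exists_mem_notMem_of_card_lt_card
    (s := (Finset.univ : Finset Bool).map .inr) (t := b) (by simp [hb])
  obtain x | c := p
  · refine ⟨x, (Finset.eq_of_subset_of_card_le ?_ ?_).symm⟩
    · rintro (v | c) hv
      · rw [inl_mem_infinityBlock.1 hv]
        exact hp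
      · exact h c
    · simp [hb, infinityBlock]
  · simp at hpn

end infinityBlock

/-- A large set of Kirkman triple systems on `L` and two points at infinity, indexed so that the
system of `x ∈ L` contains the block of `x` and infinity, in its parallel class `none`. -/
structure IsLargeSetOn {V η : Type*} (L : Finset V)
    (K : V → Option η → Set (Finset (V ⊕ Bool))) : Prop where
  isKTSOn : ∀ {x}, x ∈ L → IsKTSOn (withInfinity L) (K x)
  infinityBlock_mem : ∀ {x}, x ∈ L → infinityBlock x ∈ K x none
  disjoint : ∀ {x y i j b}, x ∈ L → y ∈ L → b ∈ K x i → b ∈ K y j → x = y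

open Classical in
lemma LKTS.exists_isLargeSetOn {q : ℕ} (h : LKTS (q + 2)) {V η : Type*} [Fintype η]
    (hη : 2 * Fintype.card η + 1 = q) (L : Finset V) (hL : L.card = q) :
    ∃ K : V → Option η → Set (Finset (V ⊕ Bool)), IsLargeSetOn L K := by
  obtain ⟨B, hB, hdisj⟩ := h
  let e : Fin (q + 2) ≃ L ⊕ Bool := Fintype.equivOfCardEq (by simp [hL])
  have hthird : ∀ i, ∃ x : L, (infinityBlock x).map e.symm.toEmbedding ∈ B i := by
    intro i
    obtain ⟨b, ⟨hb, h0, h1⟩, -⟩ := (hB i).1.2 (e.symm (.inr false)) (e.symm (.inr true)) (by simp)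
    obtain ⟨x, hx⟩ := exists_eq_infinityBlock (b := b.map e.toEmbedding)
      (by simpa using (hB i).1.1 b hb) (by
        rintro (_ | _)
        · exact Finset.mem_map.2 ⟨_, h0, by simp⟩
        · exact Finset.mem_map.2 ⟨_, h1, by simp⟩)
    refine ⟨x, ?_⟩
    rw [← hx, Finset.map_map]
    have : e.toEmbedding.trans e.symm.toEmbedding = .refl _ := by ext; simp
    rwa [this, Finset.map_refl]
  choose f hf using hthird
  have hinj : Function.Injective f := fun i j hij => by
    by_contra hne
    exact Finset.disjoint_left.1 (hdisj i j hne) (hf i) (hij ▸ hf j)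
  have hbij : Function.Bijective f :=
    (Fintype.bijective_iff_injective_and_card f).2 ⟨hinj, by simp [hL]⟩
  choose g hg using hbij.2
  let φ : Fin (q + 2) ↪ V ⊕ Bool :=
    e.toEmbedding.trans ((Function.Embedding.subtype _).sumMap (.refl _))
  choose C hC hCB hC0 using fun i => (hB i).exists_isKTSOn (η := η) (by simp; omega) (hf i)
  refine ⟨fun x k => {b | ∃ hx : x ∈ L, b ∈ Finset.map φ '' C (g ⟨x, hx⟩) k}, ?_, ?_, ?_⟩
  · intro x hx
    have := (hC (g ⟨x, hx⟩)).map φ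
    have hr : φ '' Set.univ = withInfinity L := by
      ext p
      simp only [Set.image_univ, Set.mem_range]
      constructor
      · rintro ⟨a, rfl⟩
        simp only [φ, Function.Embedding.trans_apply, Equiv.coe_toEmbedding]
        rcases e a with v | c <;> simp
      · obtain v | c := p
        · intro hv
          exact ⟨e.symm (.inl ⟨v, by simpa using hv⟩), by simp [φ]⟩
        · intro _
          exact ⟨e.symm (.inr c), by simp [φ]⟩
    rw [hr] at this
    simp only [hx, exists_true_left]
    exact this
  · intro x hx
    refine ⟨hx, _, hC0 _, ?_⟩
    rw [hg, Finset.map_map]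
    ext p
    simp only [Finset.mem_map, φ]
    obtain v | c := p
    · simp [eq_comm]
    · simp
  · rintro x y i j _ hx hy ⟨_, b, hb, rfl⟩ ⟨_, b', hb', e'⟩
    rw [Finset.map_injective φ e'] at hb'
    by_contra hne
    have : g ⟨x, hx⟩ ≠ g ⟨y, hy⟩ := fun h => by
      have := congrArg f h
      rw [hg, hg] at this
      exact hne (congrArg Subtype.val this)
    exact Finset.disjoint_left.1 (hdisj _ _ this) (hCB _ _ _ hb) (hCB _ _ _ hb')

/-- A linear space on `V` with lines of size `q`, where `R x L h t` makes the triples `t` that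
belong to the point `x` into a Kirkman frame whose groups are the lines through `x`: for every
line `L` through `x` and every label `h`, they form a parallel class of the complement of `L`. -/
structure IsFrameSystem {V η : Type*} (q : ℕ) (IsLine : Finset V → Prop)
    (R : V → Finset V → η → Finset V → Prop) : Prop where
  line_card : ∀ {L}, IsLine L → L.card = q
  line_exists : ∀ y z, ∃ L, IsLine L ∧ y ∈ L ∧ z ∈ L
  line_unique : ∀ {L L' y z}, IsLine L → IsLine L' → y ≠ z → y ∈ L → z ∈ L → y ∈ L' → z ∈ L' →
    L = L'
  card : ∀ {x L h t}, R x L h t → t.card = 3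
  line : ∀ {x L h t}, R x L h t → IsLine L ∧ x ∈ L
  pair : ∀ {x y z}, (∀ L, IsLine L → x ∈ L → y ∈ L → z ∉ L) →
    ∃ L h t, R x L h t ∧ y ∈ t ∧ z ∈ t
  pair_unique : ∀ {x L L' h h' t t' y z}, R x L h t → R x L' h' t' → y ≠ z → y ∈ t → z ∈ t →
    y ∈ t' → z ∈ t' → t = t'
  not_collinear : ∀ {x L h t M y z}, R x L h t → IsLine M → y ≠ z → y ∈ t → z ∈ t →
    x ∈ M → y ∈ M → z ∉ M
  not_subset : ∀ {x L h t M}, R x L h t → IsLine M → ¬ t ⊆ M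
  center_unique : ∀ {x x' L L' h h' t}, R x L h t → R x' L' h' t → x = x'
  class_unique : ∀ {x L L' h h' t}, R x L h t → R x L' h' t → L = L' ∧ h = h'
  cover : ∀ {x L y} h, IsLine L → x ∈ L → y ∉ L → ∃ t, R x L h t ∧ y ∈ t
  cover_unique : ∀ {x L h t t' y}, R x L h t → R x L h t' → y ∈ t → y ∈ t' → t = t'
  avoid : ∀ {x L h t y}, R x L h t → y ∈ t → y ∉ L

namespace IsFrameSystem

variable {V η : Type*} {q : ℕ} {IsLine : Finset V → Prop} {R : V → Finset V → η → Finset V → Prop}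
  {K : Finset V → V → Option η → Set (Finset (V ⊕ Bool))}

/-- The parallel classes of the system of `x` obtained by filling the holes of its frame. -/
def filledClass (IsLine : Finset V → Prop) (R : V → Finset V → η → Finset V → Prop)
    (K : Finset V → V → Option η → Set (Finset (V ⊕ Bool))) (x : V) :
    Option ({L // IsLine L ∧ x ∈ L} × η) → Set (Finset (V ⊕ Bool))
  | none => {b | ∃ L, (IsLine L ∧ x ∈ L) ∧ b ∈ K L x none}
  | some (L, h) => {b | b ∈ K L x (some h) ∨ ∃ t, R x L h t ∧ b = t.map .inl}

lemma mem_filledClass {x : V} {i : Option ({L // IsLine L ∧ x ∈ L} × η)}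
    {b : Finset (V ⊕ Bool)} (hb : b ∈ filledClass IsLine R K x i) :
    (∃ L j, (IsLine L ∧ x ∈ L) ∧ b ∈ K L x j) ∨ ∃ L h t, R x L h t ∧ b = t.map .inl := by
  match i, hb with
  | none, ⟨L, hL, hb⟩ => exact .inl ⟨L, none, hL, hb⟩
  | some (L, h), .inl hb => exact .inl ⟨L, some h, L.2, hb⟩
  | some (L, h), .inr ⟨t, ht⟩ => exact .inr ⟨L, h, t, ht⟩

lemma exists_mem_filledClass {x : V} {L : Finset V} (hL : IsLine L) (hx : x ∈ L) {j : Option η}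
    {b : Finset (V ⊕ Bool)} (hb : b ∈ K L x j) : ∃ i, b ∈ filledClass IsLine R K x i := by
  match j, hb with
  | none, hb => exact ⟨none, L, ⟨hL, hx⟩, hb⟩
  | some h, hb => exact ⟨some (⟨L, hL, hx⟩, h), .inl hb⟩

variable (hF : IsFrameSystem q IsLine R) (hK : ∀ {L}, IsLine L → IsLargeSetOn L (K L))
include hF hK

omit hF in
lemma eq_infinityBlock {L : Finset V} {x : V} {i : Option η} {b : Finset (V ⊕ Bool)}
    (hL : IsLine L) (hx : x ∈ L) (hb : b ∈ K L x i) (h : ∀ c, Sum.inr c ∈ b) :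
    b = infinityBlock x :=
  ((hK hL).isKTSOn hx).pair_unique hb ((hK hL).infinityBlock_mem hx)
    (p := .inr false) (r := .inr true) (by simp) (h _) (h _) (by simp) (by simp)

open Classical in
lemma inr_mem_of_mem_of_mem {L L' : Finset V} {x x' : V} {i j : Option η} {b : Finset (V ⊕ Bool)}
    (hL : IsLine L) (hL' : IsLine L') (hx : x ∈ L) (hx' : x' ∈ L') (hne : L ≠ L')
    (hb : b ∈ K L x i) (hb' : b ∈ K L' x' j) (c : Bool) : Sum.inr c ∈ b := by
  by_contra hc
  have hcard : 1 < (b.erase (.inr !c)).card := by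
    have := ((hK hL).isKTSOn hx).card hb
    have := Finset.pred_card_le_card_erase (s := b) (a := Sum.inr !c)
    omega
  have hinl : ∀ p ∈ b.erase (.inr !c), ∃ v, p = Sum.inl v := by
    rintro (_ | d) hp
    · exact ⟨_, rfl⟩
    · rw [Finset.mem_erase] at hp
      cases c <;> cases d <;> simp_all
  obtain ⟨p, hp, r, hr, hpr⟩ := Finset.one_lt_card.1 hcard
  obtain ⟨u, rfl⟩ := hinl p hp
  obtain ⟨v, rfl⟩ := hinl r hr
  have hp := Finset.mem_of_mem_erase hp
  have hr := Finset.mem_of_mem_erase hr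
  have mem : ∀ {w}, Sum.inl w ∈ b → w ∈ L ∧ w ∈ L' := fun hw =>
    ⟨inl_mem_withInfinity.1 (((hK hL).isKTSOn hx).subset hb hw),
      inl_mem_withInfinity.1 (((hK hL').isKTSOn hx').subset hb' hw)⟩
  exact hne (hF.line_unique hL hL' (ne_of_apply_ne _ hpr) (mem hp).1 (mem hr).1
    (mem hp).2 (mem hr).2)

lemma map_inl_notMem {x y : V} {L M : Finset V} {h : η} {t : Finset V} {i : Option η}
    (ht : R x L h t) (hM : IsLine M) (hy : y ∈ M) : t.map .inl ∉ K M y i := fun hb =>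
  hF.not_subset ht hM fun _ hv =>
    inl_mem_withInfinity.1 (((hK hM).isKTSOn hy).subset hb (Finset.mem_map_of_mem _ hv))

lemma class_eq {L L' : Finset V} {x : V} {i j : Option η} {b : Finset (V ⊕ Bool)}
    (hL : IsLine L ∧ x ∈ L) (hL' : IsLine L' ∧ x ∈ L')
    (hb : b ∈ K L x i) (hb' : b ∈ K L' x j) : i = j ∧ (i ≠ none → L = L') := by
  by_cases hne : L = L'
  · subst hne
    exact ⟨((hK hL.1).isKTSOn hL.2).class_unique hb hb', fun _ => rfl⟩
  · have e := eq_infinityBlock hK hL.1 hL.2 hb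
      (inr_mem_of_mem_of_mem hF hK hL.1 hL'.1 hL.2 hL'.2 hne hb hb')
    subst e
    have hi := ((hK hL.1).isKTSOn hL.2).class_unique hb ((hK hL.1).infinityBlock_mem hL.2)
    have hj := ((hK hL'.1).isKTSOn hL'.2).class_unique hb' ((hK hL'.1).infinityBlock_mem hL'.2)
    exact ⟨hi.trans hj.symm, fun h => absurd hi h⟩

omit hK in
/-- Two points and `x` lie in the common extension of a line, or they are two affine points
not collinear with `x`. -/
lemma exists_line_or (x : V) (p r : V ⊕ Bool) :
    (∃ L, (IsLine L ∧ x ∈ L) ∧ p ∈ withInfinity L ∧ r ∈ withInfinity L) ∨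
      ∃ y z, p = .inl y ∧ r = .inl z ∧ ∀ L, IsLine L → x ∈ L → y ∈ L → z ∉ L := by
  obtain y | c := p
  · obtain z | d := r
    · by_cases h : ∃ L, (IsLine L ∧ x ∈ L) ∧ y ∈ L ∧ z ∈ L
      · obtain ⟨L, hL, hy, hz⟩ := h
        exact .inl ⟨L, hL, by simpa, by simpa⟩
      · exact .inr ⟨y, z, rfl, rfl, fun L h1 h2 h3 h4 => h ⟨L, ⟨h1, h2⟩, h3, h4⟩⟩
    · obtain ⟨L, hL, hx, hy⟩ := hF.line_exists x y
      exact .inl ⟨L, ⟨hL, hx⟩, by simpa, by simp⟩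
  · obtain z | d := r
    · obtain ⟨L, hL, hx, hz⟩ := hF.line_exists x z
      exact .inl ⟨L, ⟨hL, hx⟩, by simp, by simpa⟩
    · obtain ⟨L, hL, hx, -⟩ := hF.line_exists x x
      exact .inl ⟨L, ⟨hL, hx⟩, by simp, by simp⟩

lemma eq_of_mem_of_mem {L L' : Finset V} {x : V} {i j : Option η} {b b' : Finset (V ⊕ Bool)}
    {p : V ⊕ Bool} (hL : IsLine L ∧ x ∈ L) (hL' : IsLine L' ∧ x ∈ L')
    (hb : b ∈ K L x i) (hb' : b' ∈ K L' x j) (hp : p ∈ b) (hp' : p ∈ b') :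
    L = L' ∨ p ∈ infinityBlock x := by
  obtain v | c := p
  · by_cases hv : v = x
    · exact .inr (by simpa using hv)
    · have h1 := inl_mem_withInfinity.1 (((hK hL.1).isKTSOn hL.2).subset hb hp)
      have h2 := inl_mem_withInfinity.1 (((hK hL'.1).isKTSOn hL'.2).subset hb' hp')
      exact .inl (hF.line_unique hL.1 hL'.1 hv h1 hL.2 h2 hL'.2)
  · exact .inr (by simp)

omit hF in
lemma eq_infinityBlock_of_two_mem {L : Finset V} {x : V} {i : Option η} {b : Finset (V ⊕ Bool)}
    {p r : V ⊕ Bool} (hL : IsLine L ∧ x ∈ L) (hb : b ∈ K L x i) (hpr : p ≠ r) (hp : p ∈ b)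
    (hr : r ∈ b) (hp' : p ∈ infinityBlock x) (hr' : r ∈ infinityBlock x) :
    b = infinityBlock x :=
  ((hK hL.1).isKTSOn hL.2).pair_unique hb ((hK hL.1).infinityBlock_mem hL.2) hpr hp hr hp' hr'

lemma not_two_mem_of_map_inl {x : V} {L M : Finset V} {h : η} {t : Finset V} {i : Option η}
    {b : Finset (V ⊕ Bool)} {p r : V ⊕ Bool} (ht : R x L h t) (hM : IsLine M ∧ x ∈ M)
    (hb : b ∈ K M x i) (hpr : p ≠ r) (hp : p ∈ b) (hr : r ∈ b)
    (hp' : p ∈ t.map .inl) : r ∉ t.map .inl := fun hr' => by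
  obtain ⟨y, hy, rfl⟩ := Finset.mem_map.1 hp'
  obtain ⟨z, hz, rfl⟩ := Finset.mem_map.1 hr'
  have mem : ∀ {w}, Sum.inl w ∈ b → w ∈ M := fun hw =>
    inl_mem_withInfinity.1 (((hK hM.1).isKTSOn hM.2).subset hb hw)
  exact hF.not_collinear ht hM.1 (ne_of_apply_ne _ hpr) hy hz hM.2 (mem hp) (mem hr)

lemma filled_pair_unique {x : V} {i j : Option ({L // IsLine L ∧ x ∈ L} × η)}
    {b b' : Finset (V ⊕ Bool)} {p r : V ⊕ Bool} (hb : b ∈ filledClass IsLine R K x i)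
    (hb' : b' ∈ filledClass IsLine R K x j) (hpr : p ≠ r) (hp : p ∈ b) (hr : r ∈ b)
    (hp' : p ∈ b') (hr' : r ∈ b') : b = b' := by
  obtain ⟨L, k, hL, hb⟩ | ⟨L, h, t, ht, rfl⟩ := mem_filledClass hb <;>
    obtain ⟨L', k', hL', hb'⟩ | ⟨L', h', t', ht', rfl⟩ := mem_filledClass hb'
  · obtain rfl | h1 := eq_of_mem_of_mem hF hK hL hL' hb hb' hp hp'
    · exact ((hK hL.1).isKTSOn hL.2).pair_unique hb hb' hpr hp hr hp' hr'
    obtain rfl | h2 := eq_of_mem_of_mem hF hK hL hL' hb hb' hr hr'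
    · exact ((hK hL.1).isKTSOn hL.2).pair_unique hb hb' hpr hp hr hp' hr'
    rw [eq_infinityBlock_of_two_mem hK hL hb hpr hp hr h1 h2,
      eq_infinityBlock_of_two_mem hK hL' hb' hpr hp' hr' h1 h2]
  · exact absurd hr' (not_two_mem_of_map_inl hF hK ht' hL hb hpr hp hr hp')
  · exact absurd hr (not_two_mem_of_map_inl hF hK ht hL' hb' hpr hp' hr' hp)
  · obtain ⟨y, hy, rfl⟩ := Finset.mem_map.1 hp
    obtain ⟨z, hz, rfl⟩ := Finset.mem_map.1 hr
    rw [hF.pair_unique ht ht' (ne_of_apply_ne _ hpr) hy hz ((Finset.mem_map' _).1 hp')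
      ((Finset.mem_map' _).1 hr')]

lemma filled_class_unique {x : V} {i j : Option ({L // IsLine L ∧ x ∈ L} × η)}
    {b : Finset (V ⊕ Bool)} (hb : b ∈ filledClass IsLine R K x i)
    (hb' : b ∈ filledClass IsLine R K x j) : i = j := by
  match i, j, hb, hb' with
  | none, none, _, _ => rfl
  | none, some (L', h), ⟨L, hL, hb⟩, .inl hb' =>
    exact absurd (class_eq hF hK hL L'.2 hb hb').1 (by simp)
  | none, some (L', h), ⟨L, hL, hb⟩, .inr ⟨t, ht, e⟩ =>
    exact absurd (e ▸ hb) (map_inl_notMem hF hK ht hL.1 hL.2)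
  | some (L', h), none, .inl hb', ⟨L, hL, hb⟩ =>
    exact absurd (class_eq hF hK hL L'.2 hb hb').1 (by simp)
  | some (L', h), none, .inr ⟨t, ht, e⟩, ⟨L, hL, hb⟩ =>
    exact absurd (e ▸ hb) (map_inl_notMem hF hK ht hL.1 hL.2)
  | some (L, h), some (L', h'), .inl hb, .inl hb' =>
    obtain ⟨e1, e2⟩ := class_eq hF hK L.2 L'.2 hb hb'
    rw [Option.some.inj e1, Subtype.ext (e2 (by simp))]
  | some (L, h), some (L', h'), .inl hb, .inr ⟨t, ht, e⟩ =>
    exact absurd (e ▸ hb) (map_inl_notMem hF hK ht L.2.1 L.2.2)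
  | some (L, h), some (L', h'), .inr ⟨t, ht, e⟩, .inl hb =>
    exact absurd (e ▸ hb) (map_inl_notMem hF hK ht L'.2.1 L'.2.2)
  | some (L, h), some (L', h'), .inr ⟨t, ht, e⟩, .inr ⟨t', ht', e'⟩ =>
    obtain rfl := Finset.map_injective _ (e.symm.trans e')
    obtain ⟨e1, e2⟩ := hF.class_unique ht ht'
    rw [e2, Subtype.ext e1]

lemma filled_cover {x : V} (i : Option ({L // IsLine L ∧ x ∈ L} × η)) (p : V ⊕ Bool) :
    ∃ b ∈ filledClass IsLine R K x i, p ∈ b := by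
  match i with
  | none =>
    obtain ⟨L, hL, hp, -⟩ | ⟨y, z, rfl, h⟩ := exists_line_or hF x p p
    · obtain ⟨b, hb, hpb⟩ := ((hK hL.1).isKTSOn hL.2).cover none hp
      exact ⟨b, ⟨L, hL, hb⟩, hpb⟩
    · obtain ⟨L, hL, hx, hy⟩ := hF.line_exists x y
      obtain rfl := Sum.inl_injective h.1
      exact absurd hy (h.2 L hL hx hy)
  | some (L, h) =>
    by_cases hp : p ∈ withInfinity L.1
    · obtain ⟨b, hb, hpb⟩ := ((hK L.2.1).isKTSOn L.2.2).cover (some h) hp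
      exact ⟨b, .inl hb, hpb⟩
    · obtain y | c := p
      · obtain ⟨t, ht, hy⟩ := hF.cover h L.2.1 L.2.2 (fun h => hp (by simpa using h))
        exact ⟨_, .inr ⟨t, ht, rfl⟩, Finset.mem_map_of_mem _ hy⟩
      · simp at hp

lemma filled_cover_unique {x : V} {i : Option ({L // IsLine L ∧ x ∈ L} × η)}
    {b b' : Finset (V ⊕ Bool)} {p : V ⊕ Bool} (hb : b ∈ filledClass IsLine R K x i)
    (hb' : b' ∈ filledClass IsLine R K x i) (hp : p ∈ b) (hp' : p ∈ b') : b = b' := by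
  match i, hb, hb' with
  | none, ⟨L, hL, hb⟩, ⟨L', hL', hb'⟩ =>
    obtain rfl | h := eq_of_mem_of_mem hF hK hL hL' hb hb' hp hp'
    · exact ((hK hL.1).isKTSOn hL.2).cover_unique hb hb' hp hp'
    · rw [((hK hL.1).isKTSOn hL.2).cover_unique hb ((hK hL.1).infinityBlock_mem hL.2) hp h,
        ((hK hL'.1).isKTSOn hL'.2).cover_unique hb' ((hK hL'.1).infinityBlock_mem hL'.2) hp' h]
  | some (L, h), .inl hb, .inl hb' =>
    exact ((hK L.2.1).isKTSOn L.2.2).cover_unique hb hb' hp hp'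
  | some (L, h), .inl hb, .inr ⟨t, ht, e⟩ =>
    obtain ⟨y, hy, rfl⟩ := Finset.mem_map.1 (e ▸ hp')
    exact absurd (inl_mem_withInfinity.1 (((hK L.2.1).isKTSOn L.2.2).subset hb hp))
      (hF.avoid ht hy)
  | some (L, h), .inr ⟨t, ht, e⟩, .inl hb =>
    obtain ⟨y, hy, rfl⟩ := Finset.mem_map.1 (e ▸ hp)
    exact absurd (inl_mem_withInfinity.1 (((hK L.2.1).isKTSOn L.2.2).subset hb hp'))
      (hF.avoid ht hy)
  | some (L, h), .inr ⟨t, ht, e⟩, .inr ⟨t', ht', e'⟩ =>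
    subst e e'
    obtain ⟨y, hy, rfl⟩ := Finset.mem_map.1 hp
    rw [hF.cover_unique ht ht' hy ((Finset.mem_map' _).1 hp')]

lemma isKTSOn_filledClass (x : V) : IsKTSOn Set.univ (filledClass IsLine R K x) where
  card hb := by
    obtain ⟨L, k, hL, hb⟩ | ⟨L, h, t, ht, rfl⟩ := mem_filledClass hb
    · exact ((hK hL.1).isKTSOn hL.2).card hb
    · simpa using hF.card ht
  subset _ _ := Set.mem_univ _
  pair {p r} _ _ hpr := by
    obtain ⟨L, hL, hp, hr⟩ | ⟨y, z, rfl, rfl, h⟩ := exists_line_or hF x p r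
    · obtain ⟨i, b, hb, hpb, hrb⟩ := ((hK hL.1).isKTSOn hL.2).pair hp hr hpr
      obtain ⟨i', hb⟩ := exists_mem_filledClass (R := R) hL.1 hL.2 hb
      exact ⟨i', b, hb, hpb, hrb⟩
    · obtain ⟨L, h, t, ht, hy, hz⟩ := hF.pair h
      exact ⟨some (⟨L, hF.line ht⟩, h), _, .inr ⟨t, ht, rfl⟩, Finset.mem_map_of_mem _ hy,
        Finset.mem_map_of_mem _ hz⟩
  pair_unique := filled_pair_unique hF hK
  class_unique := filled_class_unique hF hK
  cover i p _ := filled_cover hF hK i p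
  cover_unique := filled_cover_unique hF hK

lemma filledClass_disjoint {x y : V} {i : Option ({L // IsLine L ∧ x ∈ L} × η)}
    {j : Option ({L // IsLine L ∧ y ∈ L} × η)} {b : Finset (V ⊕ Bool)}
    (hb : b ∈ filledClass IsLine R K x i) (hb' : b ∈ filledClass IsLine R K y j) : x = y := by
  obtain ⟨L, k, hL, hb⟩ | ⟨L, h, t, ht, rfl⟩ := mem_filledClass hb <;>
    obtain ⟨L', k', hL', hb'⟩ | ⟨L', h', t', ht', e⟩ := mem_filledClass hb'
  · by_cases hne : L = L'
    · subst hne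
      exact (hK hL.1).disjoint hL.2 hL'.2 hb hb'
    · have hinf := inr_mem_of_mem_of_mem hF hK hL.1 hL'.1 hL.2 hL'.2 hne hb hb'
      exact infinityBlock_injective ((eq_infinityBlock hK hL.1 hL.2 hb hinf).symm.trans
        (eq_infinityBlock hK hL'.1 hL'.2 hb' hinf))
  · exact absurd (e ▸ hb) (map_inl_notMem hF hK ht' hL.1 hL.2)
  · exact absurd hb' (map_inl_notMem hF hK ht hL'.1 hL'.2)
  · obtain rfl := Finset.map_injective _ e
    exact hF.center_unique ht ht'

omit hK in
open Classical in
theorem LKTS_card_add_two [Fintype V] [Fintype η] (hη : 2 * Fintype.card η + 1 = q)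
    (h : LKTS (q + 2)) : LKTS (Fintype.card V + 2) := by
  have hex : ∀ L, ∃ K : V → Option η → Set (Finset (V ⊕ Bool)), IsLine L → IsLargeSetOn L K := by
    intro L
    by_cases hL : IsLine L
    · obtain ⟨K, hK⟩ := h.exists_isLargeSetOn hη L (hF.line_card hL)
      exact ⟨K, fun _ => hK⟩
    · exact ⟨fun _ _ => ∅, fun h => absurd h hL⟩
  choose K hK using hex
  replace hK : ∀ {L}, IsLine L → IsLargeSetOn L (K L) := fun {L} => hK L
  let e : V ⊕ Bool ≃ Fin (Fintype.card V + 2) := Fintype.equivOfCardEq (by simp)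
  let s : Fin (Fintype.card V + 2 - 2) ≃ V := Fintype.equivOfCardEq (by simp)
  have hall : ∀ x, IsKTSOn Set.univ
      (fun i => Finset.map e.toEmbedding '' filledClass IsLine R K x i) := by
    intro x
    have := (isKTSOn_filledClass hF hK x).map e.toEmbedding
    simpa using this
  choose B hB hBmem using fun i => (hall (s i)).exists_isKTS
  refine ⟨B, hB, fun i j hij => Finset.disjoint_left.2 fun b hb hb' => ?_⟩
  obtain ⟨k, c, hc, rfl⟩ := hBmem i b hb
  obtain ⟨k', c', hc', e'⟩ := hBmem j _ hb'
  rw [Finset.map_injective _ e'] at hc'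
  exact hij (s.injective (filledClass_disjoint hF hK hc hc'))

end IsFrameSystem

section Algebra

lemma exists_homogeneous_functional (F κ : Type*) [Field F] :
    ∃ χ : (κ → F) → F, (∀ c w, χ (c • w) = c * χ w) ∧ ∀ w, χ w = 0 → w = 0 := by
  classical
  let χ : (κ → F) → F := fun w =>
    if h : (Function.support w).Nonempty then w h.some else 0
  have h0 : χ 0 = 0 := by simp [χ]
  refine ⟨χ, fun c w => ?_, fun w hw => ?_⟩
  · by_cases hc : c = 0
    · simp [hc, h0]
    · have hs : Function.support (c • w) = Function.support w := by
        ext i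
        simp [hc]
      simp only [χ, hs]
      split_ifs <;> simp
  · by_contra hne
    have hs : (Function.support w).Nonempty := Function.support_nonempty_iff.2 hne
    simp only [χ, dif_pos hs] at hw
    exact hs.some_mem hw

/-- A function of two vectors that restricts to a nonzero multiple of the determinant on every
plane. -/
structure IsPlanarDet {F V : Type*} [Field F] [AddCommGroup V] [Module F V] (D : V → V → F) :
    Prop where
  smul_add : ∀ (a b : V) (s t : F), D a (s • a + t • b) = t * D a b
  swap : ∀ a b, D b a = -D a b
  eq_smul : ∀ {a b}, a ≠ 0 → D a b = 0 → ∃ s : F, b = s • a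

lemma exists_isPlanarDet (F ι : Type*) [Field F] :
    ∃ D : (ι → F) → (ι → F) → F, IsPlanarDet D := by
  obtain ⟨χ, hχ, hχ0⟩ := exists_homogeneous_functional F (ι × ι)
  refine ⟨fun y z => χ fun p => y p.1 * z p.2 - y p.2 * z p.1, ?_, ?_, ?_⟩
  · intro a b s t
    rw [← hχ]
    congr 1
    ext p
    simp
    ring
  · intro a b
    rw [← neg_one_mul, ← hχ]
    congr 1
    ext p
    simp
    ring
  · intro a b ha h
    obtain ⟨i, hi⟩ := Function.ne_iff.1 ha
    rw [Pi.zero_apply] at hi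
    refine ⟨b i / a i, funext fun j => ?_⟩
    have := congrFun (hχ0 _ h) (i, j)
    simp only [Pi.zero_apply, Pi.smul_apply, smul_eq_mul] at this ⊢
    field_simp
    linear_combination this

namespace IsPlanarDet

variable {F V : Type*} [Field F] [AddCommGroup V] [Module F V] {D : V → V → F}
  (hD : IsPlanarDet D)
include hD

lemma smul_self (a : V) (s : F) : D a (s • a) = 0 := by
  simpa using hD.smul_add a 0 s 0

lemma ne_zero_left {a b : V} (h : D a b ≠ 0) : a ≠ 0 := by
  rintro rfl
  refine h ?_
  rw [hD.swap b 0]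
  simpa using hD.smul_self b 0

lemma rotate {a b : V} : D b (-a - b) = D a b := by
  have := hD.smul_add b a (-1) (-1)
  rw [hD.swap a b] at this
  rw [show -a - b = (-1 : F) • b + (-1 : F) • a by module, this]
  ring

lemma reflect {a b : V} : D a (-a - b) = -D a b := by
  rw [show -a - b = (-1 : F) • a + (-1 : F) • b by module, hD.smul_add]
  ring

lemma eq_zero_of_smul (d : V) (s t : F) : D (s • d) (t • d) = 0 := by
  by_cases hs : s = 0
  · by_contra h
    exact hD.ne_zero_left h (by simp [hs])
  · rw [show t • d = (t / s) • s • d by rw [smul_smul, div_mul_cancel₀ _ hs]]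
    exact hD.smul_self _ _

end IsPlanarDet

variable {F V : Type*} [Field F] [AddCommGroup V] [Module F V]

/-- `L` is an affine line of `V`. -/
def IsAffineLine (F : Type*) {V : Type*} [Field F] [AddCommGroup V] [Module F V]
    (L : Finset V) : Prop :=
  ∃ u d : V, d ≠ 0 ∧ ∀ z, z ∈ L ↔ ∃ s : F, z = u + s • d

lemma IsAffineLine.exists_direction {L : Finset V} (hL : IsAffineLine F L) {x : V} (hx : x ∈ L) :
    ∃ d : V, d ≠ 0 ∧ ∀ z, z ∈ L ↔ ∃ s : F, z = x + s • d := by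
  obtain ⟨u, d, hd, h⟩ := hL
  obtain ⟨s, rfl⟩ := (h x).1 hx
  refine ⟨d, hd, fun z => (h z).trans ⟨?_, ?_⟩⟩
  · rintro ⟨t, rfl⟩
    exact ⟨t - s, by module⟩
  · rintro ⟨t, rfl⟩
    exact ⟨s + t, by module⟩

lemma IsAffineLine.mem_iff_of_mem {L : Finset V} (hL : IsAffineLine F L) {x y : V} (hxy : x ≠ y)
    (hx : x ∈ L) (hy : y ∈ L) (z : V) : z ∈ L ↔ ∃ s : F, z = x + s • (y - x) := by
  obtain ⟨d, hd, h⟩ := hL.exists_direction hx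
  obtain ⟨t, rfl⟩ := (h y).1 hy
  have ht : t ≠ 0 := by
    rintro rfl
    simp at hxy
  refine (h z).trans ⟨?_, ?_⟩
  · rintro ⟨s, rfl⟩
    refine ⟨s / t, ?_⟩
    rw [add_sub_cancel_left, smul_smul, div_mul_cancel₀ _ ht]
  · rintro ⟨s, rfl⟩
    exact ⟨s * t, by module⟩

lemma IsAffineLine.eq_of_mem {L L' : Finset V} (hL : IsAffineLine F L) (hL' : IsAffineLine F L')
    {y z : V} (hyz : y ≠ z) (hy : y ∈ L) (hz : z ∈ L) (hy' : y ∈ L') (hz' : z ∈ L') : L = L' := by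
  ext w
  rw [hL.mem_iff_of_mem hyz hy hz, hL'.mem_iff_of_mem hyz hy' hz']

lemma exists_isAffineLine [Fintype V] {u d : V} (hd : d ≠ 0) :
    ∃ L, IsAffineLine F L ∧ ∀ z, z ∈ L ↔ ∃ s : F, z = u + s • d := by
  classical
  exact ⟨Finset.univ.filter fun z => ∃ s : F, z = u + s • d, ⟨u, d, hd, by simp⟩, by simp⟩

lemma exists_isAffineLine_mem [Fintype V] [Nontrivial V] (y z : V) :
    ∃ L, IsAffineLine F L ∧ y ∈ L ∧ z ∈ L := by
  by_cases h : z = y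
  · obtain ⟨d, hd⟩ := exists_ne (0 : V)
    obtain ⟨L, hL, hm⟩ := exists_isAffineLine (F := F) (u := y) hd
    have : y ∈ L := (hm y).2 ⟨0, by simp⟩
    exact ⟨L, hL, this, h ▸ this⟩
  · obtain ⟨L, hL, hm⟩ := exists_isAffineLine (F := F) (u := y) (sub_ne_zero.2 h)
    exact ⟨L, hL, (hm y).2 ⟨0, by simp⟩, (hm z).2 ⟨1, by simp⟩⟩

lemma IsAffineLine.card_eq [Fintype F] {L : Finset V} (hL : IsAffineLine F L) :
    L.card = Fintype.card F := by
  classical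
  obtain ⟨u, d, hd, h⟩ := hL
  have : L = Finset.univ.image fun s : F => u + s • d := by
    ext z
    simp [h, eq_comm]
  rw [this, Finset.card_image_of_injective, Finset.card_univ]
  intro s t hst
  exact smul_left_injective F hd (add_left_cancel hst)

open Classical in
/-- The triples `{x + a, x + b, x + c}` with `a + b + c = 0` and `D a b = h` for which the line `L`
joins `x` to `x + (a - ω b)`; the latter point is, up to scaling, the component of `a` in an
eigenspace of the rotation `a ↦ b ↦ c ↦ a`. -/
def centroidRel (D : V → V → F) (ω : F) (H : Set F) (x : V) (L : Finset V) (h : H)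
    (t : Finset V) : Prop :=
  IsAffineLine F L ∧ x ∈ L ∧ ∃ a b : V, t = {x + a, x + b, x + (-a - b)} ∧ D a b = h ∧
    x + (a - ω • b) ∈ L

namespace centroidRel

variable {D : V → V → F} {ω : F} {H : Set F} (hD : IsPlanarDet D) (hω : ω ^ 2 + ω + 1 = 0)
  (hH : ∀ a : F, a ∈ H → -a ∉ H) (hH0 : (0 : F) ∉ H)
include hD hω

omit hω in
lemma det_eq_zero_of_collinear {L : Finset V} (hL : IsAffineLine F L) {x a b : V}
    (hx : x ∈ L) (ha : x + a ∈ L) (hb : x + b ∈ L) : D a b = 0 := by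
  obtain ⟨d, -, h⟩ := hL.exists_direction hx
  obtain ⟨s, hs⟩ := (h _).1 ha
  obtain ⟨t, ht⟩ := (h _).1 hb
  rw [add_left_cancel hs, add_left_cancel ht]
  exact hD.eq_zero_of_smul d s t

open Classical in
lemma exists_of_mem {x : V} {L : Finset V} {h : H} {t : Finset V} {y : V}
    (ht : centroidRel D ω H x L h t) (hy : y ∈ t) :
    ∃ a b : V, y = x + a ∧ t = {x + a, x + b, x + (-a - b)} ∧ D a b = h ∧
      x + (a - ω • b) ∈ L := by
  obtain ⟨hL, hx, a, b, rfl, hab, hm⟩ := ht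
  have hω3 : ω ^ 3 = 1 := by linear_combination (ω - 1) * hω
  obtain ⟨d, -, hd⟩ := hL.exists_direction hx
  obtain ⟨s, hs⟩ := (hd _).1 hm
  have hs := add_left_cancel hs
  have e1 : b - ω • (-a - b) = (ω * s) • d := by
    rw [mul_smul, ← hs]
    linear_combination (norm := module) hω • b
  have e2 : (-a - b) - ω • a = (ω ^ 2 * s) • d := by
    rw [mul_smul, ← hs]
    linear_combination (norm := module) (-hω) • a + hω3 • b
  simp only [Finset.mem_insert, Finset.mem_singleton] at hy
  obtain rfl | rfl | rfl := hy
  · exact ⟨a, b, rfl, rfl, hab, hm⟩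
  · refine ⟨b, -a - b, rfl, ?_, hD.rotate.trans hab, (hd _).2 ⟨_, by rw [e1]⟩⟩
    rw [show -b - (-a - b) = a by abel]
    grind
  · refine ⟨-a - b, a, rfl, ?_, ?_, (hd _).2 ⟨_, by rw [e2]⟩⟩
    · rw [show -(-a - b) - a = b by abel]
      grind
    · rw [← hab, ← hD.rotate (a := a), ← hD.rotate (a := b),
        show -b - (-a - b) = a by abel]

include hH0 in
omit [AddCommGroup V] [Module F V] hD hω in
lemma det_ne_zero {h : H} {a b : V} (hab : D a b = h) : D a b ≠ 0 := fun e =>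
  hH0 (by rw [← e, hab]; exact h.2)

include hH0 in
open Classical in
lemma exists_of_mem_of_mem {x : V} {L : Finset V} {h : H} {t : Finset V} {y z : V}
    (ht : centroidRel D ω H x L h t) (hyz : y ≠ z) (hy : y ∈ t) (hz : z ∈ t) :
    ∃ a b : V, y = x + a ∧ z = x + b ∧ t = {x + a, x + b, x + (-a - b)} ∧ D a b ≠ 0 := by
  obtain ⟨a, b, rfl, rfl, hab, -⟩ := exists_of_mem hD hω ht hy
  have h0 := det_ne_zero hH0 hab
  simp only [Finset.mem_insert, Finset.mem_singleton] at hz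
  obtain rfl | rfl | rfl := hz
  · exact absurd rfl hyz
  · exact ⟨a, b, rfl, rfl, rfl, h0⟩
  · refine ⟨a, -a - b, rfl, rfl, ?_, by rwa [hD.reflect, neg_ne_zero]⟩
    rw [show -a - (-a - b) = b by abel]
    grind

omit hω in
lemma ne_of_det_ne_zero {a b : V} (h : D a b ≠ 0) : a ≠ b ∧ a ≠ -a - b ∧ b ≠ -a - b := by
  have hne : ∀ {c d : V}, D c d ≠ 0 → c ≠ d := fun h e =>
    h (by simpa [e] using hD.smul_self _ 1)
  exact ⟨hne h, hne (by rwa [hD.reflect, neg_ne_zero]), hne (by rwa [hD.rotate])⟩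

omit hD in
include hω in
lemma direction_eq {a b d : V} {s : F} (h : a - ω • b = s • d) : b = ω ^ 2 • (a - s • d) := by
  have hω3 : ω ^ 3 = 1 := by linear_combination (ω - 1) * hω
  rw [← h, sub_sub_cancel, smul_smul, ← pow_succ, hω3, one_smul]

omit hω in
lemma det_direction (a d : V) (s : F) : D a (ω ^ 2 • (a - s • d)) = -(ω ^ 2 * s) * D a d := by
  rw [← hD.smul_add a d (ω ^ 2)]
  congr 1
  module

open Classical in
include hH hH0 in
lemma class_unique {x : V} {L L' : Finset V} {h h' : H} {t : Finset V}
    (ht : centroidRel D ω H x L h t) (ht' : centroidRel D ω H x L' h' t) : L = L' ∧ h = h' := by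
  obtain ⟨hL, hx, a, b, rfl, hab, hm⟩ := ht
  have h0 := det_ne_zero hH0 hab
  obtain ⟨a', b', hy, e, hab', hm'⟩ := exists_of_mem hD hω ht' (y := x + a) (by simp)
  obtain rfl := add_left_cancel hy
  have hb : x + b ∈ ({x + a, x + b', x + (-a - b')} : Finset V) := e ▸ by simp
  simp only [Finset.mem_insert, Finset.mem_singleton, add_right_inj] at hb
  obtain rfl | rfl | rfl := hb
  · exact absurd rfl (ne_of_det_ne_zero hD h0).1
  · refine ⟨hL.eq_of_mem ht'.1 (y := x) (z := x + (a - ω • b)) ?_ hx hm ht'.2.1 hm', ?_⟩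
    · intro e
      have hz : a - ω • b = 0 := by simpa using e
      refine h0 ?_
      rw [direction_eq hω (hz.trans (zero_smul F (0 : V)).symm), det_direction hD]
      simp
    · exact Subtype.ext (hab.symm.trans hab')
  · rw [hD.reflect, hab'] at hab
    exact absurd (hab ▸ h.2) (hH _ h'.2)

open Classical in
theorem isFrameSystem [Fintype F] [Fintype V] [Nontrivial V] (h3 : (3 : F) ≠ 0) (hH : ∀ a : F, a ≠ 0 → (a ∈ H ↔ -a ∉ H))
    (hH0 : (0 : F) ∉ H) :
    IsFrameSystem (Fintype.card F) (IsAffineLine F) (centroidRel D ω H (V := V)) where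
  line_card := IsAffineLine.card_eq
  line_exists := exists_isAffineLine_mem
  line_unique hL hL' := hL.eq_of_mem hL'
  card := by
    rintro x L h t ⟨-, -, a, b, rfl, hab, -⟩
    obtain ⟨h1, h2, h3⟩ := ne_of_det_ne_zero hD (det_ne_zero hH0 hab)
    exact Finset.card_eq_three.2 ⟨_, _, _, by simpa, by simpa, by simpa, rfl⟩
  line ht := ⟨ht.1, ht.2.1⟩
  pair {x y z} hne := by
    have key : ∀ a b : V, D a b ∈ H →
        ∃ L h, centroidRel D ω H x L h {x + a, x + b, x + (-a - b)} := by
      intro a b hab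
      obtain ⟨L, hL, hx, hm⟩ := exists_isAffineLine_mem (F := F) x (x + (a - ω • b))
      exact ⟨L, ⟨_, hab⟩, hL, hx, a, b, rfl, rfl, hm⟩
    obtain ⟨a, rfl⟩ : ∃ a, y = x + a := ⟨y - x, by abel⟩
    obtain ⟨b, rfl⟩ : ∃ b, z = x + b := ⟨z - x, by abel⟩
    have hab : D a b ≠ 0 := by
      intro h0
      by_cases ha : a = 0
      · subst ha
        obtain ⟨L, hL, hx, hb⟩ := exists_isAffineLine_mem (F := F) x (x + b)
        exact hne L hL hx (by simpa) hb
      · obtain ⟨s, rfl⟩ := hD.eq_smul ha h0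
        obtain ⟨L, hL, hm⟩ := exists_isAffineLine (F := F) (u := x) ha
        exact hne L hL ((hm _).2 ⟨0, by simp⟩) ((hm _).2 ⟨1, by simp⟩) ((hm _).2 ⟨s, rfl⟩)
    by_cases hmem : D a b ∈ H
    · obtain ⟨L, h, ht⟩ := key a b hmem
      exact ⟨L, h, _, ht, by simp, by simp⟩
    · have : D b a ∈ H := by
        rw [hD.swap]
        by_contra hn
        exact hmem ((hH _ hab).2 hn)
      obtain ⟨L, h, ht⟩ := key b a this
      exact ⟨L, h, _, ht, by simp, by simp⟩
  pair_unique ht ht' hyz hy hz hy' hz' := by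
    obtain ⟨a, b, rfl, rfl, rfl, -⟩ := exists_of_mem_of_mem hD hω hH0 ht hyz hy hz
    obtain ⟨a', b', ha, hb, rfl, -⟩ := exists_of_mem_of_mem hD hω hH0 ht' hyz hy' hz'
    rw [add_left_cancel ha, add_left_cancel hb]
  not_collinear ht hM hyz hy hz hx hyM hzM := by
    obtain ⟨a, b, rfl, rfl, rfl, h0⟩ := exists_of_mem_of_mem hD hω hH0 ht hyz hy hz
    exact h0 (det_eq_zero_of_collinear hD hM hx hyM hzM)
  not_subset := by
    rintro x L h t M ⟨-, -, a, b, rfl, hab, -⟩ hM hsub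
    have ha := hsub (show x + a ∈ _ by simp)
    have hb := hsub (show x + b ∈ _ by simp)
    refine det_ne_zero hH0 hab (det_eq_zero_of_collinear hD hM (x := x) ?_ ha hb)
    obtain ⟨u, d, -, hm⟩ := hM
    obtain ⟨s₁, h₁⟩ := (hm _).1 ha
    obtain ⟨s₂, h₂⟩ := (hm _).1 hb
    obtain ⟨s₃, h₃⟩ := (hm _).1 (hsub (show x + (-a - b) ∈ _ by simp))
    refine (hm x).2 ⟨(s₁ + s₂ + s₃) / 3, smul_right_injective V h3 ?_⟩
    simp only [smul_add, smul_smul, mul_div_cancel₀ _ h3]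
    linear_combination (norm := module) h₁ + h₂ + h₃
  center_unique := by
    have hsum : ∀ {x L h t}, centroidRel D ω H (V := V) x L h t → ∑ y ∈ t, y = (3 : F) • x := by
      rintro x L h t ⟨-, -, a, b, rfl, hab, -⟩
      obtain ⟨h1, h2, h3⟩ := ne_of_det_ne_zero hD (det_ne_zero hH0 hab)
      rw [Finset.sum_insert (by simpa using ⟨h1, h2⟩), Finset.sum_insert (by simpa using h3),
        Finset.sum_singleton]
      module
    intro x x' L L' h h' t ht ht'
    exact smul_right_injective V h3 ((hsum ht).symm.trans (hsum ht'))
  class_unique := class_unique hD hω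
    (fun a ha => (hH a fun e => hH0 (e ▸ ha)).1 ha) hH0
  cover {x L y} h hL hx hy := by
    obtain ⟨d, hd, hm⟩ := hL.exists_direction hx
    obtain ⟨a, rfl⟩ : ∃ a, y = x + a := ⟨y - x, by abel⟩
    have had : D a d ≠ 0 := by
      intro h0
      rw [hD.swap, neg_eq_zero] at h0
      obtain ⟨s, rfl⟩ := hD.eq_smul hd h0
      exact hy ((hm _).2 ⟨s, rfl⟩)
    have hω3 : ω ^ 3 = 1 := by linear_combination (ω - 1) * hω
    let s : F := -(h * ω) / D a d
    refine ⟨_, ⟨hL, hx, a, ω ^ 2 • (a - s • d), rfl, ?_, (hm _).2 ⟨s, ?_⟩⟩, by simp⟩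
    · rw [det_direction hD]
      simp only [s]
      field_simp
      linear_combination (h : F) * hω3
    · rw [smul_smul, ← pow_succ', hω3]
      module
  cover_unique ht ht' hy hy' := by
    have hL := ht.1
    have hx := ht.2.1
    obtain ⟨a, b, rfl, rfl, hab, hb⟩ := exists_of_mem hD hω ht hy
    obtain ⟨a', b', ha, rfl, hab', hb'⟩ := exists_of_mem hD hω ht' hy'
    obtain rfl := add_left_cancel ha
    obtain ⟨d, -, hm⟩ := hL.exists_direction hx
    obtain ⟨s, hs⟩ := (hm _).1 hb
    obtain ⟨s', hs'⟩ := (hm _).1 hb'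
    obtain rfl := direction_eq hω (add_left_cancel hs)
    obtain rfl := direction_eq hω (add_left_cancel hs')
    have h0 := det_ne_zero hH0 hab
    have hss := hab.trans hab'.symm
    rw [det_direction hD] at h0 hss
    rw [det_direction hD] at hss
    have h1 := mul_right_cancel₀ (right_ne_zero_of_mul h0) hss
    have hω0 : ω ^ 2 ≠ 0 := fun e => h0 (by simp [e])
    rw [mul_left_cancel₀ hω0 (neg_injective h1)]
  avoid ht hy := fun hyL => by
    have hL := ht.1
    have hx := ht.2.1
    obtain ⟨a, b, rfl, -, hab, hb⟩ := exists_of_mem hD hω ht hy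
    have h0 := det_eq_zero_of_collinear hD hL hx hyL hb
    rw [show a - ω • b = (1 : F) • a + (-ω) • b by module, hD.smul_add] at h0
    have hω0 : -ω ≠ 0 := by
      intro e
      rw [neg_eq_zero.1 e] at hω
      simp at hω
    exact det_ne_zero hH0 hab ((mul_eq_zero.1 h0).resolve_left hω0)

end centroidRel

open Classical in
lemma exists_half_system (F : Type*) [Field F] [Fintype F] (h2 : (2 : F) ≠ 0) :
    ∃ H : Set F, (∀ a : F, a ≠ 0 → (a ∈ H ↔ -a ∉ H)) ∧ 0 ∉ H ∧
      2 * Fintype.card H + 1 = Fintype.card F := by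
  let e := Fintype.equivFin F
  let H : Set F := {a | e a < e (-a)}
  have hH : ∀ a : F, a ≠ 0 → (a ∈ H ↔ -a ∉ H) := by
    intro a ha
    have hne : e a ≠ e (-a) := fun h => by
      have : 2 * a = 0 := by linear_combination e.injective h
      exact (mul_ne_zero h2 ha) this
    simp only [H, Set.mem_ofPred_eq, neg_neg, not_lt]
    exact ⟨le_of_lt, fun h => lt_of_le_of_ne h hne⟩
  have hH0 : (0 : F) ∉ H := by simp [H]
  refine ⟨H, hH, hH0, ?_⟩
  clear_value H
  have hcard : (H.toFinset.map (Equiv.neg F).toEmbedding).card = H.toFinset.card :=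
    Finset.card_map _
  have hU : Finset.univ.erase (0 : F) =
      H.toFinset ∪ H.toFinset.map (Equiv.neg F).toEmbedding := by
    ext a
    simp only [Finset.mem_erase, Finset.mem_univ, and_true, Finset.mem_union, Set.mem_toFinset,
      Finset.mem_map_equiv, Equiv.neg_symm, Equiv.neg_apply]
    constructor
    · intro ha
      have := hH a ha
      tauto
    · rintro h rfl
      simp [hH0] at h
  have hdisj : Disjoint H.toFinset (H.toFinset.map (Equiv.neg F).toEmbedding) := by
    rw [Finset.disjoint_left]
    intro a ha ha'
    simp only [Set.mem_toFinset, Finset.mem_map_equiv, Equiv.neg_symm, Equiv.neg_apply] at ha ha'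
    exact (hH a fun e => hH0 (e ▸ ha)).1 ha ha'
  have hc := congrArg Finset.card hU
  rw [Finset.card_union_of_disjoint hdisj, hcard, Set.toFinset_card,
    Finset.card_erase_of_mem (Finset.mem_univ _), Finset.card_univ] at hc
  have : 0 < Fintype.card F := Fintype.card_pos
  omega

lemma exists_sq_add_self_add_one_eq_zero (F : Type*) [Field F] [Fintype F]
    (h : 3 ∣ Fintype.card F - 1) : ∃ ω : F, ω ^ 2 + ω + 1 = 0 := by
  classical
  obtain ⟨u, hu⟩ := exists_prime_orderOf_dvd_card (G := Fˣ) 3 (by rwa [Fintype.card_units])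
  have h1 : (u : F) ≠ 1 := fun e => by
    rw [Units.val_eq_one.1 e] at hu
    simp at hu
  have h3 : (u : F) ^ 3 = 1 := by
    rw [← Units.val_pow_eq_pow_val, ← hu, pow_orderOf_eq_one, Units.val_one]
  refine ⟨u, mul_left_cancel₀ (sub_ne_zero.2 h1) ?_⟩
  linear_combination h3

lemma two_ne_zero_and_three_ne_zero_of_card_mod_six (F : Type*) [Field F] [Fintype F]
    (h : Fintype.card F % 6 = 1) : (2 : F) ≠ 0 ∧ (3 : F) ≠ 0 := by
  obtain ⟨m, hm⟩ : ∃ m, Fintype.card F = 6 * m + 1 := ⟨Fintype.card F / 6, by omega⟩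
  have hcast := FiniteField.cast_card_eq_zero F
  rw [hm] at hcast
  push_cast at hcast
  refine ⟨fun e => one_ne_zero (α := F) ?_, fun e => one_ne_zero (α := F) ?_⟩
  · linear_combination hcast - 3 * m * e
  · linear_combination hcast - 2 * m * e

theorem LKTS.card_pow_add_two (F : Type*) [Field F] [Fintype F] (h1 : Fintype.card F % 6 = 1)
    (h : LKTS (Fintype.card F + 2)) {n : ℕ} (hn : n ≠ 0) : LKTS (Fintype.card F ^ n + 2) := by
  classical
  obtain ⟨h2, h3⟩ := two_ne_zero_and_three_ne_zero_of_card_mod_six F h1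
  obtain ⟨ω, hω⟩ := exists_sq_add_self_add_one_eq_zero F (by omega)
  obtain ⟨H, hH, hH0, hcard⟩ := exists_half_system F h2
  obtain ⟨D, hD⟩ := exists_isPlanarDet F (Fin n)
  have : NeZero n := ⟨hn⟩
  have hV : Fintype.card (Fin n → F) = Fintype.card F ^ n := by simp
  rw [← hV]
  exact (centroidRel.isFrameSystem hD hω h3 hH hH0).LKTS_card_add_two hcard h

end Algebra

/-- Main theorem: if an LKTS(q+2) exists for a prime power `q ≡ 1 (mod 6)`,
then an LKTS(qⁿ+2) exists for every `n ≥ 2`. -/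
theorem LKTS_prime_power_tower (q : ℕ) (hq : IsPrimePow q) (h1 : q % 6 = 1)
    (h : LKTS (q + 2)) : ∀ n : ℕ, 2 ≤ n → LKTS (q ^ n + 2) := by
  intro n hn
  obtain ⟨p, k, hp, hk, rfl⟩ := (isPrimePow_nat_iff q).1 hq
  have : Fact p.Prime := ⟨hp⟩
  let _ : Fintype (GaloisField p k) := Fintype.ofFinite _
  have hF : Fintype.card (GaloisField p k) = p ^ k := by
    rw [Fintype.card_eq_nat_card, GaloisField.card p k hk.ne']
  rw [← hF] at h1 h ⊢
  exact h.card_pow_add_two _ h1 (by omega)
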